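/- arXiv:2001.05754 — 2 statements merged into one kernel-verified Lean document; each statement's English description precedes it below -/
import Mathlib

section
/- Let s > 3/2 and k ≥ 1. Define F₁(u) = (1-∂²ₓₓ)^{-1} ∂ₓ(u^{k+1}) on the torus T. Then there is a constant C = C(s,k) such that ‖F₁(u)‖_{H^s} ≤ C ‖u‖_{W^{1,∞}}^k ‖u‖_{H^s} for all u ∈ H^s(T). -/
open Real Complex

lemma twoPiPos : (0:ℝ) < 2 * π := by positivity

/-- The `H^σ` norm of a sequence of Fourier coefficients. -/
noncomputable def seqHs (σ : ℝ) (a : ℤ → ℂ) : ℝ :=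
  Real.sqrt (∑' k : ℤ, ((1:ℝ) + (k:ℝ)^2) ^ σ * ‖a k‖^2)

/-- The `H^σ(𝕋)` Sobolev norm of a `2π`-periodic function, via Fourier coefficients. -/
noncomputable def hsNorm (σ : ℝ) (f : ℝ → ℂ) : ℝ :=
  seqHs σ (fun k => fourierCoeffOn twoPiPos f k)

/-- The `W^{1,∞}` norm `‖u‖_{L^∞} + ‖u_x‖_{L^∞}`. -/
noncomputable def w1infNorm (u : ℝ → ℂ) : ℝ :=
  (⨆ x : ℝ, ‖u x‖) + (⨆ x : ℝ, ‖deriv u x‖)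

/-- The `m`-th Fourier coefficient of `F₁(u) = (1-∂²ₓₓ)⁻¹ ∂ₓ (u^{k+1})`:
the Fourier multiplier of `(1-∂²ₓₓ)⁻¹ ∂ₓ` is `i m / (1 + m²)`. -/
noncomputable def F1coeff (k : ℕ) (u : ℝ → ℂ) (m : ℤ) : ℂ :=
  Complex.I * (m : ℂ) / (1 + (m : ℂ)^2) *
    fourierCoeffOn twoPiPos (fun x => (u x) ^ (k + 1)) m

open scoped ENNReal
open MeasureTheory

/-! ### Nonnegative sequences: Young-type inequalities in `ℝ≥0∞` -/

lemma enn_mul_le_sq_add_sq (x y : ℝ≥0∞) : x * y ≤ x ^ 2 + y ^ 2 := by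
  rcases le_total x y with h | h
  · calc x * y ≤ y * y := by gcongr
      _ = y ^ 2 := (sq y).symm
      _ ≤ _ := le_add_self
  · calc x * y ≤ x * x := by gcongr
      _ = x ^ 2 := (sq x).symm
      _ ≤ _ := le_self_add

lemma enn_add_sq_le (x y : ℝ≥0∞) : (x + y) ^ 2 ≤ 3 * (x ^ 2 + y ^ 2) := by
  calc (x + y) ^ 2 = x ^ 2 + y ^ 2 + (x * y + x * y) := by ring
    _ ≤ x ^ 2 + y ^ 2 + ((x ^ 2 + y ^ 2) + (x ^ 2 + y ^ 2)) := by
        gcongr <;> exact enn_mul_le_sq_add_sq x y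
    _ = _ := by ring

lemma enn_tsum_mul_sq_le {ι : Type*} (a b : ι → ℝ≥0∞) :
    (∑' i, a i * b i) ^ 2 ≤ 2 * (∑' i, a i) * ∑' i, a i * b i ^ 2 := by
  calc (∑' i, a i * b i) ^ 2 = ∑' i, ∑' j, (a i * b i) * (a j * b j) := by
        rw [sq, ← ENNReal.tsum_mul_right]
        simp_rw [ENNReal.tsum_mul_left]
    _ ≤ ∑' i, ∑' j, ((a i * b i ^ 2) * a j + a i * (a j * b j ^ 2)) := by
        refine ENNReal.tsum_le_tsum fun i => ENNReal.tsum_le_tsum fun j => ?_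
        calc (a i * b i) * (a j * b j) = a i * a j * (b i * b j) := by ring
          _ ≤ a i * a j * (b i ^ 2 + b j ^ 2) := by
              gcongr; exact enn_mul_le_sq_add_sq _ _
          _ = _ := by ring
    _ = _ := by
        simp_rw [ENNReal.tsum_add, ENNReal.tsum_mul_left, ENNReal.tsum_mul_right]
        ring

lemma enn_tsum_shift (g : ℤ → ℝ≥0∞) (j : ℤ) : ∑' m : ℤ, g (m - j) = ∑' m, g m :=
  (Equiv.subRight j).tsum_eq g

lemma enn_young (a b : ℤ → ℝ≥0∞) :
    ∑' m : ℤ, (∑' j, a j * b (m - j)) ^ 2 ≤ 2 * (∑' i, a i) ^ 2 * ∑' i, b i ^ 2 := by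
  calc ∑' m : ℤ, (∑' j, a j * b (m - j)) ^ 2
      ≤ ∑' m : ℤ, 2 * (∑' i, a i) * ∑' j, a j * b (m - j) ^ 2 :=
        ENNReal.tsum_le_tsum fun m => enn_tsum_mul_sq_le a (fun j => b (m - j))
    _ = 2 * (∑' i, a i) * ∑' j, a j * ∑' m : ℤ, b (m - j) ^ 2 := by
        rw [ENNReal.tsum_mul_left, ENNReal.tsum_comm]
        simp_rw [ENNReal.tsum_mul_left]
    _ = _ := by
        simp_rw [enn_tsum_shift (fun m => b m ^ 2), ENNReal.tsum_mul_right]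
        ring

lemma enn_conv_comm (a b : ℤ → ℝ≥0∞) (m : ℤ) :
    ∑' j, a j * b (m - j) = ∑' j, b j * a (m - j) := by
  rw [← (Equiv.subLeft m).tsum_eq (fun j => a j * b (m - j))]
  refine tsum_congr fun j => ?_
  simp [Equiv.subLeft, mul_comm]

lemma enn_conv_l1 (a b : ℤ → ℝ≥0∞) :
    ∑' m : ℤ, ∑' j, a j * b (m - j) = (∑' i, a i) * ∑' i, b i := by
  rw [ENNReal.tsum_comm]
  simp_rw [ENNReal.tsum_mul_left, enn_tsum_shift b, ENNReal.tsum_mul_right]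

/-- The weight `(1+m²)^{s/2}`. -/
noncomputable def wgt (s : ℝ) (m : ℤ) : ℝ≥0∞ := ENNReal.ofReal (((1:ℝ) + (m:ℝ)^2) ^ (s/2))

lemma wgt_le {s : ℝ} (hs : 0 ≤ s) (m j : ℤ) :
    wgt s m ≤ ENNReal.ofReal ((4:ℝ) ^ (s/2)) * (wgt s j + wgt s (m - j)) := by
  unfold wgt
  rw [← ENNReal.ofReal_add (by positivity) (by positivity), ← ENNReal.ofReal_mul (by positivity)]
  apply ENNReal.ofReal_le_ofReal
  have hs2 : 0 ≤ s / 2 := by linarith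
  push_cast
  generalize (j:ℝ) = x
  generalize (m:ℝ) = y
  rcases le_total (1 + x ^ 2) (1 + (y - x) ^ 2) with h | h
  · calc (1 + y ^ 2) ^ (s/2) ≤ (4 * (1 + (y - x) ^ 2)) ^ (s/2) := by
          apply Real.rpow_le_rpow (by positivity) _ hs2
          nlinarith [sq_nonneg (y - 2 * x)]
      _ = 4 ^ (s/2) * (1 + (y - x) ^ 2) ^ (s/2) := Real.mul_rpow (by positivity) (by positivity)
      _ ≤ _ := by
          gcongr
          exact le_add_of_nonneg_left (by positivity)
  · calc (1 + y ^ 2) ^ (s/2) ≤ (4 * (1 + x ^ 2)) ^ (s/2) := by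
          apply Real.rpow_le_rpow (by positivity) _ hs2
          nlinarith [sq_nonneg (y - 2 * x)]
      _ = 4 ^ (s/2) * (1 + x ^ 2) ^ (s/2) := Real.mul_rpow (by positivity) (by positivity)
      _ ≤ _ := by
          gcongr
          exact le_add_of_nonneg_right (by positivity)

noncomputable def tnorm (s : ℝ) (a : ℤ → ℝ≥0∞) : ℝ≥0∞ := ∑' m, (wgt s m * a m) ^ 2

lemma tnorm_conv {s : ℝ} (hs : 0 ≤ s) (a b : ℤ → ℝ≥0∞) :
    tnorm s (fun m => ∑' j, a j * b (m - j)) ≤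
      6 * ENNReal.ofReal ((4:ℝ) ^ (s/2)) ^ 2 *
        ((∑' i, b i) ^ 2 * tnorm s a + (∑' i, a i) ^ 2 * tnorm s b) := by
  set K := ENNReal.ofReal ((4:ℝ) ^ (s/2))
  unfold tnorm
  have h1 : ∀ m : ℤ, (wgt s m * ∑' j, a j * b (m - j)) ^ 2 ≤
      3 * K ^ 2 * ((∑' j, b j * (wgt s (m - j) * a (m - j))) ^ 2
        + (∑' j, a j * (wgt s (m - j) * b (m - j))) ^ 2) := by
    intro m
    have : wgt s m * ∑' j, a j * b (m - j) ≤
        K * (∑' j, b j * (wgt s (m - j) * a (m - j)) +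
          ∑' j, a j * (wgt s (m - j) * b (m - j))) := by
      rw [enn_conv_comm b (fun i => wgt s i * a i), ← ENNReal.tsum_add, ← ENNReal.tsum_mul_left,
        ← ENNReal.tsum_mul_left]
      refine ENNReal.tsum_le_tsum fun j => ?_
      calc wgt s m * (a j * b (m - j)) ≤ K * (wgt s j + wgt s (m - j)) * (a j * b (m - j)) := by
            gcongr; exact wgt_le hs m j
        _ = _ := by ring
    calc _ ≤ _ := pow_le_pow_left₀ zero_le this 2
      _ = K ^ 2 * (∑' j, b j * (wgt s (m - j) * a (m - j)) +
          ∑' j, a j * (wgt s (m - j) * b (m - j))) ^ 2 := by ring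
      _ ≤ K ^ 2 * (3 * ((∑' j, b j * (wgt s (m - j) * a (m - j))) ^ 2
        + (∑' j, a j * (wgt s (m - j) * b (m - j))) ^ 2)) := by
            gcongr; exact enn_add_sq_le _ _
      _ = _ := by ring
  calc _ ≤ _ := ENNReal.tsum_le_tsum h1
    _ = 3 * K ^ 2 * (∑' m : ℤ, (∑' j, b j * (wgt s (m - j) * a (m - j))) ^ 2
        + ∑' m : ℤ, (∑' j, a j * (wgt s (m - j) * b (m - j))) ^ 2) := by
          rw [ENNReal.tsum_mul_left, ENNReal.tsum_add]
    _ ≤ 3 * K ^ 2 * (2 * (∑' i, b i) ^ 2 * (∑' i, (wgt s i * a i) ^ 2)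
        + 2 * (∑' i, a i) ^ 2 * ∑' i, (wgt s i * b i) ^ 2) := by
          gcongr
          · exact enn_young b (fun i => wgt s i * a i)
          · exact enn_young a (fun i => wgt s i * b i)
    _ = _ := by ring

/-! ### Fourier coefficients of products -/

section circle
variable {T : ℝ} [hT : Fact (0 < T)]

lemma coeff_mul (F G : C(AddCircle T, ℂ)) (hF : Summable (fourierCoeff F)) (m : ℤ) :
    HasSum (fun j => fourierCoeff F j * fourierCoeff G (m - j)) (fourierCoeff (F * G) m) := by
  have hs := hasSum_fourier_series_of_summable hF
  let L : C(AddCircle T, ℂ) →L[ℂ] ℂ := 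
    LinearMap.mkContinuous
      { toFun := fun H => fourierCoeff (H * G) m
        map_add' := fun H₁ H₂ => by
          rw [add_mul, ContinuousMap.coe_add, fourierCoeff.add, Pi.add_apply]
          · exact ((H₁ * G).continuous.integrable_of_hasCompactSupport
              (HasCompactSupport.of_compactSpace _))
          · exact ((H₂ * G).continuous.integrable_of_hasCompactSupport
              (HasCompactSupport.of_compactSpace _))
        map_smul' := fun c H => by
          simp only [ContinuousMap.coe_smul, smul_mul_assoc]
          rw [fourierCoeff.const_smul]
          rfl } ‖G‖ (fun H => by
      simp only [LinearMap.coe_mk, AddHom.coe_mk]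
      unfold fourierCoeff
      have := norm_integral_le_of_norm_le_const (μ := AddCircle.haarAddCircle (T := T))
        (f := fun t => fourier (-m) t • ((H * G : C(AddCircle T, ℂ)) t)) (C := ‖G‖ * ‖H‖)
        (Filter.Eventually.of_forall fun t => by
          rw [norm_smul, ContinuousMap.mul_apply, norm_mul]
          have h1 : ‖fourier (-m) t‖ = 1 := by
            rw [fourier_apply]; exact Circle.norm_coe _
          rw [h1, one_mul, mul_comm]
          exact mul_le_mul (G.norm_coe_le_norm t) (H.norm_coe_le_norm t) (norm_nonneg _)
            (norm_nonneg _))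
      simpa using this)
  have h2 := L.hasSum hs
  have h3 : L F = fourierCoeff (⇑(F * G)) m := rfl
  rw [h3] at h2
  convert h2 using 1
  ext j
  simp only [map_smul, smul_eq_mul]
  congr 1
  change fourierCoeff G (m - j) = fourierCoeff (⇑(fourier j * G : C(AddCircle T, ℂ))) m
  unfold fourierCoeff
  congr 1
  ext t
  simp only [ContinuousMap.mul_apply, smul_eq_mul]
  rw [← mul_assoc, ← fourier_add]
  congr 2
  ring_nf

lemma coeff_mul_le (F G : C(AddCircle T, ℂ)) (hF : Summable (fourierCoeff F)) (m : ℤ) :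
    ‖fourierCoeff (F * G) m‖ₑ ≤ ∑' j, ‖fourierCoeff F j‖ₑ * ‖fourierCoeff G (m - j)‖ₑ := by
  have := (coeff_mul F G hF m).tsum_eq
  rw [← this]
  simp_rw [← enorm_mul]
  exact enorm_tsum_le_tsum_enorm

lemma coeff_pow {s : ℝ} (hs : 0 ≤ s) (F : C(AddCircle T, ℂ)) (hF : Summable (fourierCoeff F))
    (k : ℕ) :
    (∑' m, ‖fourierCoeff (F ^ (k+1)) m‖ₑ ≤ (∑' m, ‖fourierCoeff F m‖ₑ) ^ (k+1)) ∧
    tnorm s (fun m => ‖fourierCoeff (F ^ (k+1)) m‖ₑ) ≤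
      (12 * ENNReal.ofReal ((4:ℝ) ^ (s/2)) ^ 2 + 1) ^ k * (∑' m, ‖fourierCoeff F m‖ₑ) ^ (2 * k) *
        tnorm s (fun m => ‖fourierCoeff F m‖ₑ) := by
  induction k with
  | zero => simp
  | succ k ih =>
    obtain ⟨ih1, ih2⟩ := ih
    set L := ∑' m, ‖fourierCoeff F m‖ₑ
    set K := ENNReal.ofReal ((4:ℝ) ^ (s/2))
    set N := tnorm s (fun m => ‖fourierCoeff F m‖ₑ)
    have hm : ∀ m, ‖fourierCoeff (F ^ (k+1+1)) m‖ₑ ≤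
        ∑' j, ‖fourierCoeff F j‖ₑ * ‖fourierCoeff (F ^ (k+1)) (m - j)‖ₑ := by
      intro m
      have := coeff_mul_le F (F ^ (k+1)) hF m
      rw [pow_succ' F (k+1)]
      exact this
    constructor
    · calc _ ≤ _ := ENNReal.tsum_le_tsum hm
        _ = L * _ := enn_conv_l1 (fun j => ‖fourierCoeff F j‖ₑ)
              (fun j => ‖fourierCoeff (F ^ (k+1)) j‖ₑ)
        _ ≤ L * L ^ (k+1) := by gcongr
        _ = _ := by ring
    · set Q := 12 * K ^ 2 + 1
      have hQ1 : 1 ≤ Q := le_add_self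
      calc _ ≤ tnorm s (fun m => ∑' j, ‖fourierCoeff F j‖ₑ * ‖fourierCoeff (F ^ (k+1)) (m - j)‖ₑ) := by
            unfold tnorm
            gcongr
            exact hm _
        _ ≤ _ := tnorm_conv hs (fun j => ‖fourierCoeff F j‖ₑ)
              (fun j => ‖fourierCoeff (F ^ (k+1)) j‖ₑ)
        _ ≤ 6 * K ^ 2 * ((L ^ (k+1)) ^ 2 * N + L ^ 2 * (Q ^ k * L ^ (2 * k) * N)) := by
            gcongr
        _ ≤ 6 * K ^ 2 * ((L ^ (k+1)) ^ 2 * (Q ^ k * N) + L ^ 2 * (Q ^ k * L ^ (2 * k) * N)) := by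
            gcongr
            exact le_mul_of_one_le_left zero_le (one_le_pow₀ hQ1)
        _ = (12 * K ^ 2) * (Q ^ k * L ^ (2 * (k+1)) * N) := by ring
        _ ≤ Q * (Q ^ k * L ^ (2 * (k+1)) * N) := by
            gcongr
            exact le_self_add
        _ = _ := by ring

end circle

/-! ### The `ℓ¹` bound -/

lemma parseval_bd {f : ℝ → ℂ} (hf : Continuous f) {M : ℝ} (hM : ∀ x, ‖f x‖ ≤ M) :
    Summable (fun i => ‖fourierCoeffOn twoPiPos f i‖ ^ 2) ∧
      ∑' i, ‖fourierCoeffOn twoPiPos f i‖ ^ 2 ≤ M ^ 2 := by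
  have hL2 : MemLp f 2 (volume.restrict (Set.Ioc 0 (2 * π))) :=
    MemLp.of_bound hf.aestronglyMeasurable M (Filter.Eventually.of_forall hM)
  have h := hasSum_sq_fourierCoeffOn twoPiPos hL2
  refine ⟨h.summable, ?_⟩
  rw [h.tsum_eq]
  have h1 : ∫ x in (0:ℝ)..(2 * π), ‖f x‖ ^ 2 ≤ ∫ x in (0:ℝ)..(2 * π), M ^ 2 := by
    apply intervalIntegral.integral_mono_on twoPiPos.le
    · exact (hf.norm.pow 2).intervalIntegrable _ _
    · simp
    · intro x _
      exact pow_le_pow_left₀ (norm_nonneg _) (hM x) 2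
  rw [intervalIntegral.integral_const] at h1
  simp only [sub_zero, smul_eq_mul] at h1 ⊢
  calc _ ≤ (2 * π)⁻¹ * (2 * π * M ^ 2) := by gcongr
    _ = M ^ 2 := by field_simp

lemma bdd_of_periodic {f : ℝ → ℂ} (hf : Continuous f) (hp : Function.Periodic f (2 * π)) :
    BddAbove (Set.range fun x => ‖f x‖) := by
  have h := hp.compact_of_continuous (by positivity) hf
  obtain ⟨C, hC⟩ := h.isBounded.exists_norm_le
  refine ⟨C, ?_⟩
  rintro _ ⟨x, rfl⟩
  exact hC _ ⟨x, rfl⟩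

noncomputable def fwt (n : ℤ) : ℝ := if n = 0 then 1 else |(n:ℝ)|⁻¹

lemma fwt_summable : Summable (fun n => fwt n ^ 2) := by
  have h : Summable (fun n : ℤ => 1 / (n:ℝ) ^ 2) := by
    exact Real.summable_one_div_int_pow.mpr one_lt_two
  have h0 : Summable (fun n : ℤ => if n = 0 then (1:ℝ) else 0) :=
    (hasSum_ite_eq (0:ℤ) (1:ℝ)).summable
  refine (h.add h0).congr fun n => ?_
  unfold fwt
  split_ifs with hn <;> simp [hn]

lemma l1_bound : ∃ C : ℝ, 0 < C ∧ ∀ u : ℝ → ℂ, ContDiff ℝ 1 u → Function.Periodic u (2 * π) →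
    0 ≤ w1infNorm u ∧
    Summable (fun m => ‖fourierCoeffOn twoPiPos u m‖) ∧
      ∑' m, ‖fourierCoeffOn twoPiPos u m‖ ≤ C * w1infNorm u := by
  refine ⟨Real.sqrt (∑' n, fwt n ^ 2) + 1, by positivity, fun u hu hp => ?_⟩
  have hdc : Continuous (deriv u) := hu.continuous_deriv le_rfl
  have hdp : Function.Periodic (deriv u) (2 * π) := by
    intro x
    rw [← deriv_comp_add_const]
    congr 1
    exact funext hp
  set M := ⨆ x : ℝ, ‖u x‖ with hMdef
  set D := ⨆ x : ℝ, ‖deriv u x‖ with hDdef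
  have hM : ∀ x, ‖u x‖ ≤ M := fun x => le_ciSup (bdd_of_periodic hu.continuous hp) x
  have hD : ∀ x, ‖deriv u x‖ ≤ D := fun x => le_ciSup (bdd_of_periodic hdc hdp) x
  have hM0 : 0 ≤ M := (norm_nonneg _).trans (hM 0)
  have hD0 : 0 ≤ D := (norm_nonneg _).trans (hD 0)
  have hW : w1infNorm u = M + D := rfl
  rw [hW]
  obtain ⟨s1, b1⟩ := parseval_bd hu.continuous hM
  obtain ⟨s2, b2⟩ := parseval_bd hdc hD
  set c := fun n => fourierCoeffOn twoPiPos u n with hc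
  set d := fun n => fourierCoeffOn twoPiPos (deriv u) n with hd
  have hcd : ∀ n : ℤ, n ≠ 0 → ‖c n‖ = |(n:ℝ)|⁻¹ * ‖d n‖ := by
    intro n hn
    have h := fourierCoeffOn_of_hasDerivAt twoPiPos (f := u) (f' := deriv u) hn
      (fun x _ => (hu.differentiable one_ne_zero x).hasDerivAt) (hdc.intervalIntegrable _ _)
    have h2 : u (2 * π) = u 0 := by simpa using hp 0
    rw [h2] at h
    have hn' : (n:ℂ) ≠ 0 := by exact_mod_cast hn
    have h3 : c n = (Complex.I * n)⁻¹ * d n := by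
      simp only [hc, hd]
      rw [h]
      have : (π:ℂ) ≠ 0 := by exact_mod_cast Real.pi_ne_zero
      push_cast
      field_simp
      ring
    rw [h3]
    simp
  let g : ℤ → ℝ := fun n => if n = 0 then ‖c 0‖ else ‖d n‖
  have hg0 : ∀ n, 0 ≤ g n := fun n => by
    simp only [g]; split_ifs <;> positivity
  have hf0 : ∀ n, 0 ≤ fwt n := fun n => by
    unfold fwt; split_ifs <;> positivity
  have hfg : ∀ n, fwt n * g n = ‖c n‖ := by
    intro n
    simp only [fwt, g]
    split_ifs with hn
    · simp [hn]
    · exact (hcd n hn).symm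
  have hc0 : ‖c 0‖ ^ 2 ≤ M ^ 2 := (s1.le_tsum 0 (fun _ _ => by positivity)).trans b1
  have hgle : ∀ n, g n ^ 2 ≤ (if n = 0 then ‖c 0‖ ^ 2 else 0) + ‖d n‖ ^ 2 := by
    intro n
    simp only [g]
    split_ifs with hn
    · exact le_add_of_nonneg_right (by positivity)
    · simp
  have hsingle := hasSum_ite_eq (0:ℤ) (‖c 0‖ ^ 2)
  have hsum2 := hsingle.summable.add s2
  have hgs : Summable (fun n => g n ^ 2) :=
    Summable.of_nonneg_of_le (fun n => by positivity) hgle hsum2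
  have hgb : ∑' n, g n ^ 2 ≤ (M + D) ^ 2 := by
    calc _ ≤ _ := hgs.tsum_le_tsum hgle hsum2
      _ = ‖c 0‖ ^ 2 + ∑' n, ‖d n‖ ^ 2 := by
        rw [hsingle.summable.tsum_add s2, hsingle.tsum_eq]
      _ ≤ M ^ 2 + D ^ 2 := add_le_add hc0 b2
      _ ≤ _ := by nlinarith
  have H := Real.summable_and_inner_le_Lp_mul_Lq_tsum_of_nonneg Real.HolderConjugate.two_two
    hf0 hg0 (by simpa using fwt_summable) (by simpa using hgs)
  simp only [hfg, Real.rpow_two] at H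
  refine ⟨by positivity, H.1, H.2.trans ?_⟩
  rw [← Real.sqrt_eq_rpow, ← Real.sqrt_eq_rpow]
  have : Real.sqrt (∑' n, g n ^ 2) ≤ M + D := by
    rw [Real.sqrt_le_left (by positivity)]
    exact hgb
  gcongr
  linarith

/-! ### Final assembly -/

lemma wgt_sq (s : ℝ) (m : ℤ) (z : ℂ) :
    (wgt s m * ‖z‖ₑ) ^ 2 = ENNReal.ofReal (((1:ℝ) + (m:ℝ)^2) ^ s * ‖z‖ ^ 2) := by
  unfold wgt
  rw [← ofReal_norm, ← ENNReal.ofReal_mul (by positivity),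
    ← ENNReal.ofReal_pow (by positivity), mul_pow, ← Real.rpow_natCast (_ ^ (s/2)),
    ← Real.rpow_mul (by positivity)]
  congr 4
  push_cast
  ring

theorem F1_Hs_estimate (s : ℝ) (hs : 3/2 < s) (k : ℕ) (hk : 1 ≤ k) :
    ∃ C : ℝ, 0 < C ∧ ∀ u : ℝ → ℂ, ContDiff ℝ 1 u → Function.Periodic u (2 * π) →
      Summable (fun m : ℤ =>
        ((1:ℝ) + (m:ℝ)^2) ^ s * ‖fourierCoeffOn twoPiPos u m‖^2) →
      seqHs s (F1coeff k u) ≤ C * (w1infNorm u) ^ k * hsNorm s u := by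
  obtain ⟨C₀, hC₀, hl1⟩ := l1_bound
  set Q : ℝ := 12 * ((4:ℝ) ^ (s/2)) ^ 2 + 1 with hQ
  have hQ0 : 0 < Q := by positivity
  refine ⟨Real.sqrt (Q ^ k) * C₀ ^ k, by positivity, fun u hu hp hsum => ?_⟩
  obtain ⟨hW, hs1, hb1⟩ := hl1 u hu hp
  have hs0 : 0 ≤ s := by linarith
  have hT : Fact (0 < 2 * π - 0) := ⟨by linarith [twoPiPos]⟩
  have hcont : Continuous (AddCircle.liftIoc (2 * π - 0) 0 u) := by
    apply AddCircle.liftIoc_continuous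
    · have := hp 0
      simpa using this.symm
    · exact hu.continuous.continuousOn
  let F : C(AddCircle (2 * π - 0), ℂ) := ⟨_, hcont⟩
  have hcF : ∀ m, fourierCoeffOn twoPiPos u m = fourierCoeff F m := fun m => rfl
  have hcFk : ∀ m, fourierCoeffOn twoPiPos (fun x => u x ^ (k+1)) m
      = fourierCoeff (⇑(F ^ (k+1))) m := fun m => rfl
  have hFs : Summable (fourierCoeff F) := hs1.of_norm
  have hmain := (coeff_pow hs0 F hFs k).2
  set A := ∑' m : ℤ, ‖fourierCoeffOn twoPiPos u m‖ with hA
  have hA0 : 0 ≤ A := tsum_nonneg fun _ => norm_nonneg _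
  set N := ∑' m : ℤ, ((1:ℝ) + (m:ℝ)^2) ^ s * ‖fourierCoeffOn twoPiPos u m‖^2 with hN
  have hN0 : 0 ≤ N := tsum_nonneg fun _ => by positivity
  have hL : ∑' m, ‖fourierCoeff F m‖ₑ = ENNReal.ofReal A := by
    rw [hA, ENNReal.ofReal_tsum_of_nonneg (fun _ => norm_nonneg _) hs1]
    simp_rw [ofReal_norm, hcF]
  have hTN : tnorm s (fun m => ‖fourierCoeff F m‖ₑ) = ENNReal.ofReal N := by
    rw [hN, ENNReal.ofReal_tsum_of_nonneg (fun _ => by positivity) hsum]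
    unfold tnorm
    simp_rw [wgt_sq, hcF]
  have hQe : 12 * ENNReal.ofReal ((4:ℝ) ^ (s/2)) ^ 2 + 1 = ENNReal.ofReal Q := by
    rw [hQ, ENNReal.ofReal_add (by positivity) (by positivity), ENNReal.ofReal_mul (by positivity),
      ENNReal.ofReal_pow (by positivity)]
    simp
  rw [hL, hTN, hQe, ← ENNReal.ofReal_pow hQ0.le, ← ENNReal.ofReal_pow hA0,
    ← ENNReal.ofReal_mul (by positivity), ← ENNReal.ofReal_mul (by positivity)] at hmain
  unfold tnorm at hmain
  simp_rw [wgt_sq] at hmain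
  have hmult : ∀ m : ℤ, ‖F1coeff k u m‖ ≤
      ‖fourierCoeff (⇑(F ^ (k+1))) m‖ := by
    intro m
    unfold F1coeff
    rw [hcFk, norm_mul]
    apply mul_le_of_le_one_left (norm_nonneg _)
    have e : (1 + (m:ℂ)^2) = (((1 + (m:ℝ)^2 : ℝ)) : ℂ) := by push_cast; rfl
    have e2 : ‖(m:ℂ)‖ = |(m:ℝ)| := by simp
    rw [norm_div, norm_mul, Complex.norm_I, one_mul, e, Complex.norm_real, e2, Real.norm_eq_abs,
      abs_of_pos (by positivity : (0:ℝ) < 1 + (m:ℝ)^2), div_le_one (by positivity)]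
    nlinarith [sq_abs (m:ℝ), sq_nonneg (|(m:ℝ)| - 1)]
  have hfin : ∑' m : ℤ, ((1:ℝ) + (m:ℝ)^2) ^ s * ‖F1coeff k u m‖^2 ≤ Q ^ k * A ^ (2 * k) * N := by
    apply Real.tsum_le_of_sum_le (fun m => by positivity)
    intro S
    rw [← ENNReal.ofReal_le_ofReal_iff (by positivity)]
    refine le_trans ?_ hmain
    rw [ENNReal.ofReal_sum_of_nonneg (fun m _ => by positivity)]
    refine le_trans (Finset.sum_le_sum fun m _ => ?_) (ENNReal.sum_le_tsum S)
    apply ENNReal.ofReal_le_ofReal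
    have := hmult m
    gcongr
  unfold hsNorm seqHs
  rw [← hN]
  calc _ ≤ Real.sqrt (Q ^ k * A ^ (2 * k) * N) := Real.sqrt_le_sqrt hfin
    _ = Real.sqrt (Q ^ k) * A ^ k * Real.sqrt N := by
      rw [Real.sqrt_mul (by positivity), Real.sqrt_mul (by positivity), mul_comm 2 k, pow_mul,
        Real.sqrt_sq (by positivity)]
    _ ≤ Real.sqrt (Q ^ k) * (C₀ * w1infNorm u) ^ k * Real.sqrt N := by gcongr
    _ = _ := by rw [mul_pow]; ring
end

section
/- Let s > 3/2 and k ≥ 1. Let F(u) = F₁(u) + F₂(u) + F₃(u), where F₁(u) = (1-∂²ₓₓ)^{-1}∂ₓ(u^{k+1}), F₂(u) = ((2k-1)/2)(1-∂²ₓₓ)^{-1}∂ₓ(u^{k-1}u_x²), F₃(u) = ((k-1)/2)(1-∂²ₓₓ)^{-1}(u^{k-2}u_x³) (with F₃ = 0 when k = 1). Then there exists C = C(s,k) > 0 such that for all u, v ∈ H^s(T), ‖F(u) - F(v)‖_{H^s} ≤ C (‖u‖_{H^s} + ‖v‖_{H^s})^k ‖u - v‖_{H^s}. -/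
open Real Complex

/-- The `m`-th Fourier coefficient of
`F(u) = (1-∂²ₓₓ)⁻¹∂ₓ(u^{k+1}) + ((2k-1)/2)(1-∂²ₓₓ)⁻¹∂ₓ(u^{k-1}u_x²)
        + ((k-1)/2)(1-∂²ₓₓ)⁻¹(u^{k-2}u_x³)`
(the last term vanishing for `k = 1` thanks to the factor `(k-1)/2`). -/
noncomputable def Fcoeff (k : ℕ) (u : ℝ → ℂ) (m : ℤ) : ℂ :=
  Complex.I * (m : ℂ) / (1 + (m : ℂ)^2) *
      fourierCoeffOn twoPiPos (fun x => (u x) ^ (k + 1)) m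
  + (2 * (k : ℂ) - 1) / 2 * (Complex.I * (m : ℂ) / (1 + (m : ℂ)^2)) *
      fourierCoeffOn twoPiPos (fun x => (u x) ^ (k - 1) * (deriv u x)^2) m
  + ((k : ℂ) - 1) / 2 * (1 / (1 + (m : ℂ)^2)) *
      fourierCoeffOn twoPiPos (fun x => (u x) ^ (k - 2) * (deriv u x)^3) m

/-- Bound `M` for the `h^σ` norm of a sequence, including summability. -/
def HB (σ : ℝ) (a : ℤ → ℂ) (M : ℝ) : Prop :=
  0 ≤ M ∧ Summable (fun m : ℤ => ((1:ℝ) + (m:ℝ)^2) ^ σ * ‖a m‖^2) ∧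
    ∑' m : ℤ, ((1:ℝ) + (m:ℝ)^2) ^ σ * ‖a m‖^2 ≤ M ^ 2

lemma wpos (σ : ℝ) (m : ℤ) : 0 < ((1:ℝ) + (m:ℝ)^2) ^ σ := by positivity

lemma HB.mono {σ : ℝ} {a : ℤ → ℂ} {M M' : ℝ} (h : HB σ a M) (hM : M ≤ M') : HB σ a M' :=
  ⟨h.1.trans hM, h.2.1, h.2.2.trans (pow_le_pow_left₀ h.1 hM 2)⟩

lemma HB.seq_le {σ : ℝ} {a : ℤ → ℂ} {M : ℝ} (h : HB σ a M) : seqHs σ a ≤ M :=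
  Real.sqrt_le_iff.2 ⟨h.1, h.2.2⟩

lemma HB.of_summable {σ : ℝ} {a : ℤ → ℂ}
    (h : Summable (fun m : ℤ => ((1:ℝ) + (m:ℝ)^2) ^ σ * ‖a m‖^2)) : HB σ a (seqHs σ a) := by
  refine ⟨Real.sqrt_nonneg _, h, ?_⟩
  rw [seqHs, Real.sq_sqrt]
  exact tsum_nonneg fun m => by positivity

lemma HB.of_le {σ τ : ℝ} {a b : ℤ → ℂ} {M : ℝ} (h : HB σ a M)
    (hab : ∀ m : ℤ, ((1:ℝ) + (m:ℝ)^2) ^ τ * ‖b m‖^2 ≤ ((1:ℝ) + (m:ℝ)^2) ^ σ * ‖a m‖^2) :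
    HB τ b M := by
  have hs : Summable (fun m : ℤ => ((1:ℝ) + (m:ℝ)^2) ^ τ * ‖b m‖^2) :=
    Summable.of_nonneg_of_le (fun m => by positivity) hab h.2.1
  exact ⟨h.1, hs, (hs.tsum_le_tsum hab h.2.1).trans h.2.2⟩

lemma HB.add {σ : ℝ} {a b : ℤ → ℂ} {M N : ℝ} (ha : HB σ a M) (hb : HB σ b N) :
    HB σ (fun m => a m + b m) (2 * (M + N)) := by
  have key : ∀ m : ℤ, ((1:ℝ) + (m:ℝ)^2) ^ σ * ‖a m + b m‖^2 ≤
      2 * (((1:ℝ) + (m:ℝ)^2) ^ σ * ‖a m‖^2) + 2 * (((1:ℝ) + (m:ℝ)^2) ^ σ * ‖b m‖^2) := by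
    intro m
    have h1 : ‖a m + b m‖^2 ≤ 2 * ‖a m‖^2 + 2 * ‖b m‖^2 := by
      have := norm_add_le (a m) (b m)
      have := pow_le_pow_left₀ (norm_nonneg _) this 2
      nlinarith [sq_nonneg (‖a m‖ - ‖b m‖)]
    nlinarith [mul_le_mul_of_nonneg_left h1 (wpos σ m).le]
  have hs2 := (ha.2.1.mul_left 2).add (hb.2.1.mul_left 2)
  have hs := Summable.of_nonneg_of_le (fun m : ℤ => by positivity) key hs2
  have hM := ha.1
  have hN := hb.1
  refine ⟨by positivity, hs, (hs.tsum_le_tsum key hs2).trans ?_⟩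
  rw [(ha.2.1.mul_left 2).tsum_add (hb.2.1.mul_left 2), tsum_mul_left, tsum_mul_left]
  nlinarith [ha.2.2, hb.2.2, mul_nonneg hM hN]

lemma HB.smul {σ : ℝ} {a : ℤ → ℂ} {M : ℝ} (h : HB σ a M) (c : ℂ) :
    HB σ (fun m => c * a m) (‖c‖ * M) := by
  have e : (fun m : ℤ => ((1:ℝ) + (m:ℝ)^2) ^ σ * ‖c * a m‖^2) =
      fun m : ℤ => ‖c‖^2 * (((1:ℝ) + (m:ℝ)^2) ^ σ * ‖a m‖^2) := by
    ext m; rw [norm_mul]; ring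
  have hM := h.1
  refine ⟨by positivity, ?_, ?_⟩
  · rw [e]; exact h.2.1.mul_left _
  · rw [e, tsum_mul_left, mul_pow]
    exact mul_le_mul_of_nonneg_left h.2.2 (by positivity)

lemma cs_tsum {p q r : ℤ → ℝ} (hp : ∀ n, 0 ≤ p n) (hq : ∀ n, 0 ≤ q n) (hr : ∀ n, 0 ≤ r n)
    (hps : Summable p) (hqs : Summable q) (h : ∀ n, r n ^ 2 ≤ p n * q n) :
    Summable r ∧ (∑' n, r n) ^ 2 ≤ (∑' n, p n) * ∑' n, q n := by
  have h2 : (2:ℝ).HolderConjugate 2 := by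
    rw [Real.holderConjugate_iff]; norm_num
  have ep : (fun n => Real.sqrt (p n) ^ (2:ℝ)) = p := by
    ext n; rw [Real.rpow_two, Real.sq_sqrt (hp n)]
  have eq : (fun n => Real.sqrt (q n) ^ (2:ℝ)) = q := by
    ext n; rw [Real.rpow_two, Real.sq_sqrt (hq n)]
  have H := Real.summable_and_inner_le_Lp_mul_Lq_tsum_of_nonneg h2
    (f := fun n => Real.sqrt (p n)) (g := fun n => Real.sqrt (q n))
    (fun n => Real.sqrt_nonneg _) (fun n => Real.sqrt_nonneg _) (by rw [ep]; exact hps)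
    (by rw [eq]; exact hqs)
  rw [ep, eq] at H
  have hle : ∀ n, r n ≤ Real.sqrt (p n) * Real.sqrt (q n) := fun n => by
    rw [← Real.sqrt_mul (hp n)]; exact Real.le_sqrt_of_sq_le (h n)
  have hs : Summable r := Summable.of_nonneg_of_le hr hle H.1
  refine ⟨hs, ?_⟩
  have h3 := (hs.tsum_le_tsum hle H.1).trans H.2
  rw [← Real.sqrt_eq_rpow, ← Real.sqrt_eq_rpow] at h3
  have h4 := pow_le_pow_left₀ (tsum_nonneg hr) h3 2
  rwa [mul_pow, Real.sq_sqrt (tsum_nonneg hp), Real.sq_sqrt (tsum_nonneg hq)] at h4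

lemma w_inv_summable {σ : ℝ} (hσ : 1/2 < σ) :
    Summable (fun m : ℤ => (((1:ℝ) + (m:ℝ)^2) ^ σ)⁻¹) := by
  have h := Real.summable_abs_int_rpow (b := 2 * σ) (by linarith)
  refine Summable.of_norm_bounded_eventually h ?_
  have : {(0:ℤ)}ᶜ ∈ Filter.cofinite := (Set.finite_singleton (0:ℤ)).compl_mem_cofinite
  filter_upwards [this] with m hm
  have hm : m ≠ 0 := hm
  have hm' : 0 < |(m:ℝ)| := by positivity
  rw [Real.norm_of_nonneg (by positivity), Real.rpow_neg hm'.le, Real.rpow_mul hm'.le,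
    Real.rpow_two, sq_abs]
  have : (0:ℝ) < (m:ℝ)^2 := by positivity
  gcongr
  linarith

lemma w_split {σ : ℝ} (hσ : 0 ≤ σ) (m n : ℤ) :
    ((1:ℝ) + (m:ℝ)^2) ^ σ ≤
      4 ^ σ * (((1:ℝ) + (n:ℝ)^2) ^ σ + ((1:ℝ) + ((m - n : ℤ):ℝ)^2) ^ σ) := by
  have h0 : (1:ℝ) + (m:ℝ)^2 ≤ 4 * max ((1:ℝ) + (n:ℝ)^2) ((1:ℝ) + ((m - n : ℤ):ℝ)^2) := by
    have h1 := le_max_left ((1:ℝ) + (n:ℝ)^2) ((1:ℝ) + ((m - n : ℤ):ℝ)^2)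
    have h2 := le_max_right ((1:ℝ) + (n:ℝ)^2) ((1:ℝ) + ((m - n : ℤ):ℝ)^2)
    push_cast at *
    nlinarith [sq_nonneg ((n:ℝ) - (m - n))]
  have h1 := Real.rpow_le_rpow (by positivity) h0 hσ
  rw [Real.mul_rpow (by norm_num) (by positivity)] at h1
  refine h1.trans ?_
  gcongr
  have a1 := wpos σ n
  have a2 := wpos σ (m - n)
  rcases max_choice ((1:ℝ) + (n:ℝ)^2) ((1:ℝ) + ((m - n : ℤ):ℝ)^2) with h | h <;> rw [h] <;> linarith

lemma conv_bound {σ : ℝ} (hσ : 1/2 < σ) : ∃ K : ℝ, 1 ≤ K ∧ ∀ (a b c : ℤ → ℂ) (M N : ℝ),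
    HB σ a M → HB σ b N → (∀ m, c m = ∑' n, a n * b (m - n)) → HB σ c (K * (M * N)) := by
  set P : ℤ → ℝ := fun m : ℤ => (((1:ℝ) + (m:ℝ)^2) ^ σ)⁻¹ with hP
  have hPs : Summable P := w_inv_summable hσ
  have hP0 : ∀ n, 0 ≤ P n := fun n => by positivity
  set S := ∑' n, P n with hS
  have hS0 : 0 ≤ S := tsum_nonneg hP0
  refine ⟨1 + 4 ^ σ * (2 * S), le_add_of_nonneg_right (by positivity), ?_⟩
  intro a b c M N ha hb hc
  set W : ℤ → ℝ := fun m : ℤ => ((1:ℝ) + (m:ℝ)^2) ^ σ with hW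
  have hW0 : ∀ m, 0 < W m := wpos σ
  set g : ℤ → ℝ := fun m => W m * ‖a m‖^2 with hg
  set h : ℤ → ℝ := fun m => W m * ‖b m‖^2 with hh
  have hg0 : ∀ m, 0 ≤ g m := fun m => mul_nonneg (hW0 m).le (by positivity)
  have hh0 : ∀ m, 0 ≤ h m := fun m => mul_nonneg (hW0 m).le (by positivity)
  have hgs : Summable g := ha.2.1
  have hhs : Summable h := hb.2.1
  have hshift : ∀ {f : ℤ → ℝ}, Summable f → ∀ m, Summable (fun n => f (m - n)) := by
    intro f hf m
    exact (Equiv.subLeft m).summable_iff.2 hf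
  have tshift : ∀ (f : ℤ → ℝ) m, ∑' n, f (m - n) = ∑' n, f n := by
    intro f m
    exact (Equiv.subLeft m).tsum_eq f
  -- the double sum
  have hprod : Summable (fun x : ℤ × ℤ => g x.1 * h x.2) := hgs.mul_of_nonneg hhs hg0 hh0
  let e : ℤ × ℤ ≃ ℤ × ℤ :=
    { toFun := fun x => (x.2, x.1 - x.2)
      invFun := fun x => (x.1 + x.2, x.1)
      left_inv := fun x => by ext <;> simp
      right_inv := fun x => by ext <;> simp }
  have hprod' : Summable (fun x : ℤ × ℤ => g x.2 * h (x.1 - x.2)) := e.summable_iff.2 hprod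
  have hconv : Summable (fun m => ∑' n, g n * h (m - n)) := hprod'.prod
  have hrow : ∀ m, Summable (fun n => g n * h (m - n)) := fun m => hprod'.prod_factor m
  have htot : ∑' m, ∑' n, g n * h (m - n) = (∑' n, g n) * ∑' n, h n := by
    rw [hgs.tsum_mul_tsum hhs hprod, ← hprod'.tsum_prod]
    exact e.tsum_eq (fun x : ℤ × ℤ => g x.1 * h x.2)
  have hsplit : ∀ m n, W m * (P n * P (m - n)) ≤ 4 ^ σ * (P n + P (m - n)) := by
    intro m n
    have h1 := w_split (σ := σ) (by linarith) m n
    have h2 : W m ≤ 4 ^ σ * (W n + W (m - n)) := h1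
    calc W m * (P n * P (m - n)) ≤ (4 ^ σ * (W n + W (m - n))) * (P n * P (m - n)) := by
          gcongr
      _ = 4 ^ σ * ((W n * P n) * P (m - n) + (W (m - n) * P (m - n)) * P n) := by ring
      _ = 4 ^ σ * (P n + P (m - n)) := by
          have e1 : ∀ n, W n * P n = 1 := fun n => mul_inv_cancel₀ (hW0 n).ne'
          rw [e1, e1]; ring
  have hPP : ∀ m, Summable (fun n => P n * P (m - n)) := by
    intro m
    have hb : Summable (fun n => (W m)⁻¹ * (4 ^ σ * (P n + P (m - n)))) :=
      ((hPs.add (hshift hPs m)).mul_left _).mul_left _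
    refine Summable.of_nonneg_of_le (fun n => mul_nonneg (hP0 _) (hP0 _)) (fun n => ?_) hb
    exact (le_inv_mul_iff₀ (hW0 m)).2 (hsplit m n)
  have hPPt : ∀ m, W m * ∑' n, P n * P (m - n) ≤ 4 ^ σ * (2 * S) := by
    intro m
    rw [← tsum_mul_left]
    refine ((hPP m).mul_left _ |>.tsum_le_tsum (hsplit m)
      ((hPs.add (hshift hPs m)).mul_left _)).trans_eq ?_
    rw [tsum_mul_left, hPs.tsum_add (hshift hPs m), tshift]
    ring
  have hpt : ∀ m, W m * ‖c m‖^2 ≤ 4 ^ σ * (2 * S) * ∑' n, g n * h (m - n) := by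
    intro m
    have hcs := cs_tsum (p := fun n => P n * P (m - n)) (q := fun n => g n * h (m - n))
      (r := fun n => ‖a n * b (m - n)‖) (fun n => mul_nonneg (hP0 _) (hP0 _))
      (fun n => mul_nonneg (hg0 _) (hh0 _)) (fun n => norm_nonneg _) (hPP m) (hrow m) (fun n => by
        have e1 : ∀ n, P n * W n = 1 := fun n => inv_mul_cancel₀ (hW0 n).ne'
        apply le_of_eq
        calc ‖a n * b (m - n)‖^2 = 1 * 1 * (‖a n‖^2 * ‖b (m - n)‖^2) := by rw [norm_mul]; ring
          _ = (P n * W n) * (P (m - n) * W (m - n)) * (‖a n‖^2 * ‖b (m - n)‖^2) := by rw [e1, e1]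
          _ = _ := by simp only [hg, hh]; ring)
    have h1 : ‖c m‖ ≤ ∑' n, ‖a n * b (m - n)‖ := by
      rw [hc]; exact norm_tsum_le_tsum_norm hcs.1
    have h2 := (pow_le_pow_left₀ (norm_nonneg _) h1 2).trans hcs.2
    have hQ : 0 ≤ ∑' n, g n * h (m - n) := tsum_nonneg fun n => mul_nonneg (hg0 _) (hh0 _)
    calc W m * ‖c m‖^2 ≤ W m * ((∑' n, P n * P (m - n)) * ∑' n, g n * h (m - n)) :=
          mul_le_mul_of_nonneg_left h2 (hW0 m).le
      _ = (W m * (∑' n, P n * P (m - n))) * ∑' n, g n * h (m - n) := by ring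
      _ ≤ _ := mul_le_mul_of_nonneg_right (hPPt m) hQ
  have hsum : Summable (fun m => W m * ‖c m‖^2) :=
    Summable.of_nonneg_of_le (fun m => mul_nonneg (hW0 m).le (by positivity)) hpt
      (hconv.mul_left _)
  have hM := ha.1
  have hN := hb.1
  refine ⟨by positivity, hsum, (hsum.tsum_le_tsum hpt (hconv.mul_left _)).trans ?_⟩
  rw [tsum_mul_left, htot]
  have hG : ∑' n, g n ≤ M^2 := ha.2.2
  have hH : ∑' n, h n ≤ N^2 := hb.2.2
  have hGH : (∑' n, g n) * ∑' n, h n ≤ M^2 * N^2 :=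
    mul_le_mul hG hH (tsum_nonneg hh0) (by positivity)
  have hK : 4 ^ σ * (2 * S) ≤ (1 + 4 ^ σ * (2 * S))^2 := by
    have : 0 ≤ 4 ^ σ * (2 * S) := by positivity
    nlinarith
  calc _ ≤ (1 + 4 ^ σ * (2 * S))^2 * (M^2 * N^2) :=
        mul_le_mul hK hGH (mul_nonneg (tsum_nonneg hg0) (tsum_nonneg hh0)) (by positivity)
    _ = _ := by ring

lemma HB.summable {σ : ℝ} (hσ : 1/2 < σ) {a : ℤ → ℂ} {M : ℝ} (h : HB σ a M) :
    Summable a := by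
  have := cs_tsum (p := fun m : ℤ => (((1:ℝ) + (m:ℝ)^2) ^ σ)⁻¹)
    (q := fun m : ℤ => ((1:ℝ) + (m:ℝ)^2) ^ σ * ‖a m‖^2) (r := fun m => ‖a m‖)
    (fun n => by positivity) (fun n => by positivity) (fun n => norm_nonneg _)
    (w_inv_summable hσ) h.2.1 (fun n => by
      rw [← mul_assoc, inv_mul_cancel₀ (wpos σ n).ne', one_mul])
  exact this.1.of_norm

instance factTwoPi : Fact (0 < 2 * π) := ⟨twoPiPos⟩

lemma coeffOn_eq (F : C(AddCircle (2 * π), ℂ)) (f : ℝ → ℂ)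
    (h : ∀ x : ℝ, f x = F (x : AddCircle (2 * π))) (n : ℤ) :
    fourierCoeffOn twoPiPos f n = fourierCoeff F n := by
  rw [fourierCoeffOn_eq_integral, fourierCoeff_eq_intervalIntegral F n 0]
  simp only [fourier_coe_apply, h, sub_zero, zero_add]

lemma exists_lift (f : ℝ → ℂ) (hf : Continuous f) (hp : Function.Periodic f (2 * π)) :
    ∃ F : C(AddCircle (2 * π), ℂ), ∀ x : ℝ, f x = F (x : AddCircle (2 * π)) :=
  ⟨⟨hp.lift, continuous_coinduced_dom.mpr hf⟩, fun x => (hp.lift_coe x).symm⟩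

lemma circle_integrable (F : C(AddCircle (2 * π), ℂ)) :
    MeasureTheory.Integrable F AddCircle.haarAddCircle :=
  F.continuous.integrable_of_hasCompactSupport (HasCompactSupport.of_compactSpace _)

lemma fc_add (F G : C(AddCircle (2 * π), ℂ)) (n : ℤ) :
    fourierCoeff (F + G : C(AddCircle (2 * π), ℂ)) n = fourierCoeff F n + fourierCoeff G n := by
  have := fourierCoeff.add (circle_integrable F) (circle_integrable G)
  rw [ContinuousMap.coe_add, this]; rfl

lemma fc_neg (F : C(AddCircle (2 * π), ℂ)) (n : ℤ) :
    fourierCoeff (-F : C(AddCircle (2 * π), ℂ)) n = - fourierCoeff F n := by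
  have := fourierCoeff.const_mul F (-1) n
  simp only [neg_one_mul] at this
  exact this

lemma fc_sub (F G : C(AddCircle (2 * π), ℂ)) (n : ℤ) :
    fourierCoeff (F - G : C(AddCircle (2 * π), ℂ)) n = fourierCoeff F n - fourierCoeff G n := by
  rw [sub_eq_add_neg, fc_add, fc_neg, sub_eq_add_neg]

/-- convolution theorem -/
lemma fc_mul (F G : C(AddCircle (2 * π), ℂ)) (hF : Summable (fourierCoeff F)) (m : ℤ) :
    fourierCoeff (F * G : C(AddCircle (2 * π), ℂ)) m =
      ∑' n, fourierCoeff F n * fourierCoeff G (m - n) := by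
  have h1 := hasSum_fourier_series_of_summable hF
  have key : ∀ n, fourierCoeff F n * fourierCoeff G (m - n) =
      ∫ x, fourier (-m) x • ((fourierCoeff F n • fourier n * G : C(AddCircle (2 * π), ℂ)) x)
        ∂AddCircle.haarAddCircle := by
    intro n
    rw [fourierCoeff.eq_def G, ← MeasureTheory.integral_const_mul]
    congr 1
    ext x
    have : -(m - n) = -m + n := by ring
    rw [this, fourier_add]
    simp only [ContinuousMap.mul_apply, ContinuousMap.smul_apply, smul_eq_mul]
    ring
  have hnorm : ∀ n, ‖(fourierCoeff F n • fourier n * G : C(AddCircle (2 * π), ℂ))‖ ≤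
      ‖fourierCoeff F n‖ * ‖G‖ := by
    intro n
    refine (norm_mul_le _ _).trans ?_
    rw [norm_smul, fourier_norm, mul_one]
  have hG : HasSum (fun n => (fourierCoeff F n • fourier n * G : C(AddCircle (2 * π), ℂ)))
      (F * G) := h1.mul_right G
  simp_rw [key]
  symm
  rw [fourierCoeff.eq_def]
  refine HasSum.tsum_eq ?_
  refine MeasureTheory.hasSum_integral_of_dominated_convergence
    (fun n _ => ‖fourierCoeff F n‖ * ‖G‖) ?_ ?_ ?_ ?_ ?_
  · intro n
    exact Continuous.aestronglyMeasurable (by fun_prop)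
  · intro n
    refine Filter.Eventually.of_forall fun x => ?_
    rw [norm_smul]
    have h2 : ‖fourier (-m) x‖ ≤ 1 := by
      have := (fourier (T := 2 * π) (-m)).norm_coe_le_norm x
      rwa [fourier_norm] at this
    have h3 := ((fourierCoeff F n • fourier n * G :
      C(AddCircle (2 * π), ℂ)).norm_coe_le_norm x).trans (hnorm n)
    calc _ ≤ 1 * (‖fourierCoeff F n‖ * ‖G‖) := mul_le_mul h2 h3 (norm_nonneg _) zero_le_one
      _ = _ := one_mul _
  · exact Filter.Eventually.of_forall fun x => hF.norm.mul_right _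
  · exact MeasureTheory.integrable_const _
  · refine Filter.Eventually.of_forall fun x => ?_
    have h4 := hG.map (ContinuousMap.evalCLM ℂ x : C(AddCircle (2 * π), ℂ) →L[ℂ] ℂ)
      (ContinuousMap.evalCLM ℂ x : C(AddCircle (2 * π), ℂ) →L[ℂ] ℂ).continuous
    exact h4.const_smul _

lemma fc_one (σ : ℝ) : HB σ (fourierCoeff (1 : C(AddCircle (2 * π), ℂ))) 1 := by
  have h0 : (⇑(1 : C(AddCircle (2 * π), ℂ))) = fourier 0 := by
    ext x; simp
  have h : fourierCoeff (1 : C(AddCircle (2 * π), ℂ)) = Pi.single 0 1 := by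
    rw [h0, fourierCoeff_fourier]
  have hs : HasSum (fun m : ℤ => ((1:ℝ) + (m:ℝ)^2) ^ σ * ‖fourierCoeff (1 : C(AddCircle (2 * π), ℂ)) m‖^2) 1 := by
    rw [h]
    convert hasSum_single (0:ℤ) ?_ using 1
    · simp
    · intro m hm
      simp [hm]
  refine ⟨zero_le_one, hs.summable, ?_⟩
  rw [hs.tsum_eq]; norm_num

lemma coeff_deriv (u : ℝ → ℂ) (hu : ContDiff ℝ 1 u) (hp : Function.Periodic u (2 * π)) (n : ℤ) :
    fourierCoeffOn twoPiPos (deriv u) n = Complex.I * n * fourierCoeffOn twoPiPos u n := by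
  have hd : Differentiable ℝ u := hu.differentiable (by norm_num)
  have hc : Continuous (deriv u) := hu.continuous_deriv (by norm_num)
  have hper : u (2 * π) = u 0 := by simpa using hp 0
  by_cases hn : n = 0
  · subst hn
    rw [fourierCoeffOn_eq_integral]
    have := intervalIntegral.integral_deriv_eq_sub (f := u) (a := 0) (b := 2 * π)
      (fun x _ => hd x) (hc.intervalIntegrable _ _)
    simp [this, hper]
  · rw [fourierCoeffOn_of_hasDerivAt twoPiPos hn (fun x _ => (hd x).hasDerivAt)
      (hc.intervalIntegrable _ _), hper]
    have hn' : (n : ℂ) ≠ 0 := by exact_mod_cast hn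
    have hpi : (π : ℂ) ≠ 0 := by exact_mod_cast Real.pi_ne_zero
    push_cast
    field_simp
    simp
    ring

lemma deriv_periodic (u : ℝ → ℂ) (hp : Function.Periodic u (2 * π)) :
    Function.Periodic (deriv u) (2 * π) := by
  intro x
  rw [← deriv_comp_add_const]
  congr 1
  ext y; exact hp y

/-- Lipschitz-type bound for a pair of homogeneous expressions of degree `n`. -/
def LP (σ A D : ℝ) (n : ℕ) (c : ℝ) (F G : C(AddCircle (2 * π), ℂ)) : Prop :=
  HB σ (fourierCoeff F) (c * A ^ n) ∧ HB σ (fourierCoeff G) (c * A ^ n) ∧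
    HB σ (fourierCoeff (F - G : C(AddCircle (2 * π), ℂ))) (c * (n * A ^ (n - 1) * D))

lemma alg_bound {σ : ℝ} (hσ : 1/2 < σ) : ∃ K : ℝ, 1 ≤ K ∧
    ∀ (F G : C(AddCircle (2 * π), ℂ)) (M N : ℝ),
    HB σ (fourierCoeff F) M → HB σ (fourierCoeff G) N →
      HB σ (fourierCoeff (F * G : C(AddCircle (2 * π), ℂ))) (K * (M * N)) := by
  obtain ⟨K, hK, h⟩ := conv_bound hσ
  refine ⟨K, hK, fun F G M N hF hG => h _ _ _ M N hF hG ?_⟩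
  exact fun m => fc_mul F G (hF.summable hσ) m

lemma nat_pow_aux (A : ℝ) (n₁ n₂ : ℕ) :
    (n₁ : ℝ) * A ^ (n₁ - 1) * A ^ n₂ + A ^ n₁ * (n₂ * A ^ (n₂ - 1)) =
      ((n₁ + n₂ : ℕ) : ℝ) * A ^ (n₁ + n₂ - 1) := by
  rcases n₁ with _ | a
  · simp
  rcases n₂ with _ | b
  · simp
  have e : a + 1 + (b + 1) - 1 = a + b + 1 := by omega
  rw [e]
  simp only [Nat.add_sub_cancel]
  push_cast
  ring

lemma LP.mul {σ A D K : ℝ} (hA : 0 ≤ A)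
    (hK : 1 ≤ K) (h : ∀ (F G : C(AddCircle (2 * π), ℂ)) (M N : ℝ),
    HB σ (fourierCoeff F) M → HB σ (fourierCoeff G) N →
      HB σ (fourierCoeff (F * G : C(AddCircle (2 * π), ℂ))) (K * (M * N)))
    {n₁ n₂ : ℕ} {c₁ c₂ : ℝ} (hc₁ : 0 ≤ c₁) (hc₂ : 0 ≤ c₂) {F₁ F₂ G₁ G₂ : C(AddCircle (2 * π), ℂ)}
    (h₁ : LP σ A D n₁ c₁ F₁ G₁) (h₂ : LP σ A D n₂ c₂ F₂ G₂) :
    LP σ A D (n₁ + n₂) (2 * K * (c₁ * c₂)) (F₁ * F₂) (G₁ * G₂) := by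
  have hp : K * ((c₁ * A ^ n₁) * (c₂ * A ^ n₂)) ≤ 2 * K * (c₁ * c₂) * A ^ (n₁ + n₂) := by
    rw [pow_add]
    have : 0 ≤ K * ((c₁ * A ^ n₁) * (c₂ * A ^ n₂)) := by positivity
    nlinarith
  refine ⟨(h _ _ _ _ h₁.1 h₂.1).mono hp, (h _ _ _ _ h₁.2.1 h₂.2.1).mono hp, ?_⟩
  have h3 := (h _ _ _ _ h₁.2.2 h₂.1).add (h _ _ _ _ h₁.2.1 h₂.2.2)
  have e : F₁ * F₂ - G₁ * G₂ = (F₁ - G₁) * F₂ + G₁ * (F₂ - G₂) := by ring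
  have e2 : fourierCoeff (F₁ * F₂ - G₁ * G₂ : C(AddCircle (2 * π), ℂ)) = fun m =>
      fourierCoeff ((F₁ - G₁) * F₂ : C(AddCircle (2 * π), ℂ)) m +
      fourierCoeff (G₁ * (F₂ - G₂) : C(AddCircle (2 * π), ℂ)) m := by
    ext m; rw [e, fc_add]
  rw [e2]
  refine h3.mono (le_of_eq ?_)
  rw [← nat_pow_aux]
  ring

lemma LP.pow {σ A D K : ℝ} (hA : 0 ≤ A)
    (hK : 1 ≤ K) (h : ∀ (F G : C(AddCircle (2 * π), ℂ)) (M N : ℝ),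
    HB σ (fourierCoeff F) M → HB σ (fourierCoeff G) N →
      HB σ (fourierCoeff (F * G : C(AddCircle (2 * π), ℂ))) (K * (M * N)))
    {F G : C(AddCircle (2 * π), ℂ)}
    (h₁ : LP σ A D 1 1 F G) (n : ℕ) :
    LP σ A D n ((2 * K) ^ n) (F ^ n) (G ^ n) := by
  induction n with
  | zero =>
    refine ⟨by simpa using fc_one σ, by simpa using fc_one σ, ?_⟩
    have e : fourierCoeff (F ^ 0 - G ^ 0 : C(AddCircle (2 * π), ℂ)) = fun _ => 0 := by
      ext m; rw [fc_sub]; simp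
    rw [e]
    refine ⟨by simp, ?_, ?_⟩ <;> simp [summable_zero]
  | succ n ih =>
    have := LP.mul hA hK h (by positivity) zero_le_one ih h₁
    rw [← pow_succ, ← pow_succ] at this
    convert this using 1
    ring

lemma mult_bound {s c A D : ℝ} {n k : ℕ} (hn : n = k + 1)
    {F G : C(AddCircle (2 * π), ℂ)}
    (h : LP (s - 1) A D n c F G) (μ : ℤ → ℂ) (hμ : ∀ m : ℤ, ‖μ m‖^2 ≤ (1 + (m:ℝ)^2)⁻¹) :
    HB s (fun m => μ m * (fourierCoeff F m - fourierCoeff G m)) ((c * n) * (A ^ k * D)) := by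
  have h1 := h.2.2
  subst hn
  refine (h1.of_le (τ := s) (b := fun m => μ m * (fourierCoeff F m - fourierCoeff G m)) ?_).mono
    (le_of_eq ?_)
  · intro m
    rw [fc_sub, norm_mul, mul_pow, Real.rpow_sub (by positivity), Real.rpow_one, div_eq_mul_inv,
      mul_assoc]
    have := hμ m
    gcongr
  · simp only [Nat.add_sub_cancel]; ring

lemma mu1 (m : ℤ) : ‖Complex.I * (m : ℂ) / (1 + (m : ℂ)^2)‖^2 ≤ (1 + (m:ℝ)^2)⁻¹ := by
  have e : (1 + (m : ℂ)^2) = ((1 + (m:ℝ)^2 : ℝ) : ℂ) := by push_cast; ring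
  have hp : (0:ℝ) < 1 + (m:ℝ)^2 := by positivity
  rw [e, norm_div, norm_mul, Complex.norm_I, one_mul, Complex.norm_real,
    Real.norm_of_nonneg hp.le, Complex.norm_intCast, div_pow, sq_abs, div_le_iff₀ (by positivity)]
  have : (1 + (m:ℝ)^2)⁻¹ * (1 + (m:ℝ)^2)^2 = 1 + (m:ℝ)^2 := by field_simp
  rw [this]; linarith

lemma mu2 (m : ℤ) : ‖1 / (1 + (m : ℂ)^2)‖^2 ≤ (1 + (m:ℝ)^2)⁻¹ := by
  have e : (1 + (m : ℂ)^2) = ((1 + (m:ℝ)^2 : ℝ) : ℂ) := by push_cast; ring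
  have hp : (0:ℝ) < 1 + (m:ℝ)^2 := by positivity
  rw [e, norm_div, norm_one, Complex.norm_real,
    Real.norm_of_nonneg hp.le, div_pow, div_le_iff₀ (by positivity)]
  have : (1 + (m:ℝ)^2)⁻¹ * (1 + (m:ℝ)^2)^2 = 1 + (m:ℝ)^2 := by field_simp
  rw [this]; nlinarith [sq_nonneg (m:ℝ)]

lemma lower {s M : ℝ} {a : ℤ → ℂ} (h : HB s a M) : HB (s - 1) a M := by
  refine h.of_le fun m => ?_
  have : (1:ℝ) ≤ 1 + (m:ℝ)^2 := by nlinarith [sq_nonneg (m:ℝ)]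
  gcongr
  linarith

lemma lower_deriv {s M : ℝ} {a b : ℤ → ℂ} (h : HB s a M) (hb : ∀ m, b m = Complex.I * m * a m) :
    HB (s - 1) b M := by
  refine h.of_le fun m => ?_
  have hp : (0:ℝ) < 1 + (m:ℝ)^2 := by positivity
  rw [hb, norm_mul, norm_mul, Complex.norm_I, one_mul, Complex.norm_intCast, mul_pow, sq_abs,
    Real.rpow_sub hp, Real.rpow_one, div_mul_eq_mul_div, div_le_iff₀ hp]
  have : 0 ≤ (1 + (m:ℝ)^2) ^ s * ‖a m‖^2 := by positivity
  nlinarith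

lemma Fcoeff_lift (k : ℕ) (u : ℝ → ℂ) (U U' : C(AddCircle (2 * π), ℂ))
    (hU : ∀ x : ℝ, u x = U (x : AddCircle (2 * π)))
    (hU' : ∀ x : ℝ, deriv u x = U' (x : AddCircle (2 * π))) (m : ℤ) :
    Fcoeff k u m = Complex.I * (m : ℂ) / (1 + (m : ℂ)^2) *
      fourierCoeff (U ^ (k + 1) : C(AddCircle (2 * π), ℂ)) m
  + (2 * (k : ℂ) - 1) / 2 * (Complex.I * (m : ℂ) / (1 + (m : ℂ)^2)) *
      fourierCoeff (U ^ (k - 1) * U' ^ 2 : C(AddCircle (2 * π), ℂ)) m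
  + ((k : ℂ) - 1) / 2 * (1 / (1 + (m : ℂ)^2)) *
      fourierCoeff (U ^ (k - 2) * U' ^ 3 : C(AddCircle (2 * π), ℂ)) m := by
  rw [Fcoeff, coeffOn_eq (U ^ (k + 1)) (fun x => (u x) ^ (k + 1)) (fun x => by simp [hU]),
    coeffOn_eq (U ^ (k - 1) * U' ^ 2) (fun x => (u x) ^ (k - 1) * (deriv u x)^2)
      (fun x => by rw [hU, hU']; rfl),
    coeffOn_eq (U ^ (k - 2) * U' ^ 3) (fun x => (u x) ^ (k - 2) * (deriv u x)^3)
      (fun x => by rw [hU, hU']; rfl)]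

theorem F_lipschitz_Hs (s : ℝ) (hs : 3/2 < s) (k : ℕ) (hk : 1 ≤ k) :
    ∃ C : ℝ, 0 < C ∧ ∀ u v : ℝ → ℂ,
      ContDiff ℝ 1 u → Function.Periodic u (2 * π) →
      ContDiff ℝ 1 v → Function.Periodic v (2 * π) →
      Summable (fun m : ℤ =>
        ((1:ℝ) + (m:ℝ)^2) ^ s * ‖fourierCoeffOn twoPiPos u m‖^2) →
      Summable (fun m : ℤ =>
        ((1:ℝ) + (m:ℝ)^2) ^ s * ‖fourierCoeffOn twoPiPos v m‖^2) →
      seqHs s (fun m => Fcoeff k u m - Fcoeff k v m) ≤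
        C * (hsNorm s u + hsNorm s v) ^ k * hsNorm s (fun x => u x - v x) := by
  obtain ⟨K, hK, hmul⟩ := alg_bound (σ := s - 1) (by linarith)
  -- constants
  obtain ⟨C₁, hC₁⟩ : ∃ C₁ : ℝ, C₁ = (2 * K) ^ (k + 1) * ((k + 1 : ℕ) : ℝ) := ⟨_, rfl⟩
  obtain ⟨C₂, hC₂⟩ : ∃ C₂ : ℝ, C₂ =
      (2 * K * ((2 * K) ^ (k - 1) * (2 * K) ^ 2)) * ((k - 1 + 2 : ℕ) : ℝ) := ⟨_, rfl⟩
  obtain ⟨C₃, hC₃⟩ : ∃ C₃ : ℝ, C₃ =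
      (2 * K * ((2 * K) ^ (k - 2) * (2 * K) ^ 3)) * ((k - 2 + 3 : ℕ) : ℝ) := ⟨_, rfl⟩
  have hC₁0 : 0 ≤ C₁ := by rw [hC₁]; positivity
  have hC₂0 : 0 ≤ C₂ := by rw [hC₂]; positivity
  have hC₃0 : 0 ≤ C₃ := by rw [hC₃]; positivity
  refine ⟨1 + 2 * (2 * (C₁ + ‖(2 * (k : ℂ) - 1) / 2‖ * C₂) + ‖((k : ℂ) - 1) / 2‖ * C₃),
    by positivity, ?_⟩
  intro u v hu hup hv hvp hus hvs
  obtain ⟨U, hU⟩ := exists_lift u hu.continuous hup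
  obtain ⟨V, hV⟩ := exists_lift v hv.continuous hvp
  obtain ⟨U', hU'⟩ := exists_lift (deriv u) (hu.continuous_deriv (by norm_num))
    (deriv_periodic u hup)
  obtain ⟨V', hV'⟩ := exists_lift (deriv v) (hv.continuous_deriv (by norm_num))
    (deriv_periodic v hvp)
  have cU : fourierCoeffOn twoPiPos u = fourierCoeff U := funext (coeffOn_eq U u hU)
  have cV : fourierCoeffOn twoPiPos v = fourierCoeff V := funext (coeffOn_eq V v hV)
  have cD : fourierCoeffOn twoPiPos (fun x => u x - v x) =
      fourierCoeff (U - V : C(AddCircle (2 * π), ℂ)) :=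
    funext (coeffOn_eq (U - V) _ fun x => by simp [hU, hV])
  have cU' : ∀ m, fourierCoeff U' m = Complex.I * m * fourierCoeff U m := fun m => by
    rw [← coeffOn_eq U' _ hU', coeff_deriv u hu hup, cU]
  have cV' : ∀ m, fourierCoeff V' m = Complex.I * m * fourierCoeff V m := fun m => by
    rw [← coeffOn_eq V' _ hV', coeff_deriv v hv hvp, cV]
  have cD' : ∀ m, fourierCoeff (U' - V' : C(AddCircle (2 * π), ℂ)) m =
      Complex.I * m * fourierCoeff (U - V : C(AddCircle (2 * π), ℂ)) m := fun m => by
    rw [fc_sub, fc_sub, cU', cV']; ring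
  have bU : HB s (fourierCoeff U) (hsNorm s u) := by
    have := HB.of_summable hus
    change HB s (fourierCoeffOn twoPiPos u) (hsNorm s u) at this
    rwa [cU] at this
  have bV : HB s (fourierCoeff V) (hsNorm s v) := by
    have := HB.of_summable hvs
    change HB s (fourierCoeffOn twoPiPos v) (hsNorm s v) at this
    rwa [cV] at this
  have bD : HB s (fourierCoeff (U - V : C(AddCircle (2 * π), ℂ)))
      (hsNorm s (fun x => u x - v x)) := by
    have h1 := (bU.add (bV.smul (-1))).2.1
    have h2 : Summable (fun m : ℤ => ((1:ℝ) + (m:ℝ)^2) ^ s *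
        ‖fourierCoeff (U - V : C(AddCircle (2 * π), ℂ)) m‖^2) := by
      refine h1.congr fun m => ?_
      simp only [fc_sub, neg_one_mul]
      rw [sub_eq_add_neg]
    have h3 := HB.of_summable h2
    have h4 : hsNorm s (fun x => u x - v x) =
        seqHs s (fourierCoeff (U - V : C(AddCircle (2 * π), ℂ))) := by
      rw [hsNorm, cD]
    rw [h4]; exact h3
  set A := hsNorm s u + hsNorm s v with hA
  set D := hsNorm s (fun x => u x - v x) with hD
  have hA0 : 0 ≤ A := add_nonneg bU.1 bV.1
  have hD0 : 0 ≤ D := bD.1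
  have bU1 := bU.mono (show hsNorm s u ≤ A from le_add_of_nonneg_right bV.1)
  have bV1 := bV.mono (show hsNorm s v ≤ A from le_add_of_nonneg_left bU.1)
  have L0 : LP (s - 1) A D 1 1 U V := by
    refine ⟨?_, ?_, ?_⟩
    · simpa using lower bU1
    · simpa using lower bV1
    · have := lower bD
      simpa using this
  have L1 : LP (s - 1) A D 1 1 U' V' := by
    refine ⟨?_, ?_, ?_⟩
    · simpa using lower_deriv bU1 cU'
    · simpa using lower_deriv bV1 cV'
    · have := lower_deriv bD cD'
      simpa using this
  have P0 := LP.pow hA0 hK hmul L0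
  have P1 := LP.pow hA0 hK hmul L1
  have X := mult_bound (s := s) rfl (P0 (k + 1)) _ mu1
  have Y := (mult_bound (s := s) (k := k) (by omega)
    (LP.mul hA0 hK hmul (by positivity) (by positivity) (P0 (k - 1)) (P1 2)) _ mu1).smul
    ((2 * (k : ℂ) - 1) / 2)
  have Z : HB s (fun m : ℤ => ((k : ℂ) - 1) / 2 * (1 / (1 + (m : ℂ)^2) *
      (fourierCoeff (U ^ (k - 2) * U' ^ 3 : C(AddCircle (2 * π), ℂ)) m -
        fourierCoeff (V ^ (k - 2) * V' ^ 3 : C(AddCircle (2 * π), ℂ)) m)))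
      (‖((k : ℂ) - 1) / 2‖ * (C₃ * (A ^ k * D))) := by
    rcases eq_or_lt_of_le hk with h1 | h1
    · subst h1
      refine ⟨by positivity, ?_, ?_⟩ <;> simp [summable_zero]
    · rw [hC₃]
      exact (mult_bound (s := s) (k := k) (by omega)
        (LP.mul hA0 hK hmul (by positivity) (by positivity) (P0 (k - 2)) (P1 3)) _ mu2).smul _
  rw [← hC₁] at X
  rw [← hC₂] at Y
  have T := (X.add Y).add Z
  have hAD : 0 ≤ A ^ k * D := by positivity
  refine (T.of_le (τ := s) (b := fun m => Fcoeff k u m - Fcoeff k v m)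
    (fun m => le_of_eq ?_)).seq_le.trans ?_
  · simp only [Fcoeff_lift k u U U' hU hU', Fcoeff_lift k v V V' hV hV']
    congr 3
    ring
  · nlinarith
end
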